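/- Let J be a Cartwright-Sturmfels* ideal of S. Then every minimal system of Z^v-homogeneous generators of J is a universal Gröbner basis of J, i.e. a Gröbner basis of J with respect to every term order on S. -/

import Mathlib

open MvPolynomial

noncomputable section

namespace CSPaper

/-- The set of variables of the standard `ℤ^v`-graded polynomial ring `S`:
the variable `x_{i j}` of the paper (with `1 ≤ i ≤ v`, `1 ≤ j ≤ n_i`) corresponds to
`⟨i-1, j-1⟩ : MVar v n` where `n (i-1) = n_i - 1`; thus row `i` has `n i + 1 > 0`
variables and the first variable `x_{i 1}` of row `i` corresponds to `⟨i, 0⟩`. -/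
abbrev MVar (v : ℕ) (n : Fin v → ℕ) : Type := Σ i : Fin v, Fin (n i + 1)

/-- The weight function giving the standard `ℤ^v`-grading: `deg (x_{i j}) = e_i ∈ ℤ^v`. -/
def wt (v : ℕ) (n : Fin v → ℕ) : MVar v n → (Fin v → ℕ) := fun p => Pi.single p.1 1

variable {K : Type} [Field K] {v : ℕ} {n : Fin v → ℕ}

/-- An ideal of `S` is `ℤ^v`-graded (multigraded) iff it contains every multihomogeneous
component of each of its elements. -/
def IsMultigraded (I : Ideal (MvPolynomial (MVar v n) K)) : Prop :=
  ∀ f ∈ I, ∀ a : Fin v → ℕ, weightedHomogeneousComponent (wt v n) a f ∈ I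

/-- The value of the `ℤ^v`-graded Hilbert function of the ideal `I` at `a ∈ ℕ^v`:
`dim_K I_a`. -/
def hilb (I : Ideal (MvPolynomial (MVar v n) K)) (a : Fin v → ℕ) : ℕ :=
  Module.finrank K
    ((Submodule.restrictScalars K I ⊓ weightedHomogeneousSubmodule K (wt v n) a :
      Submodule K (MvPolynomial (MVar v n) K)))

/-- Two ideals have the same `ℤ^v`-graded Hilbert series. -/
def sameHS (I J : Ideal (MvPolynomial (MVar v n) K)) : Prop :=
  ∀ a : Fin v → ℕ, hilb I a = hilb J a

/-- The `ℤ^v`-graded `K`-algebra endomorphism of `S` determined by a `v`-tuple of square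
matrices: `x_{i j} ↦ ∑_k (g i)_{k j} x_{i k}`.  For invertible `g i` these are exactly the
elements of `G = GL_{n_1}(K) × ⋯ × GL_{n_v}(K)` acting on `S`. -/
def gAct (g : ∀ i : Fin v, Matrix (Fin (n i + 1)) (Fin (n i + 1)) K) :
    MvPolynomial (MVar v n) K →ₐ[K] MvPolynomial (MVar v n) K :=
  aeval fun p : MVar v n => ∑ k : Fin (n p.1 + 1), C (g p.1 k p.2) * X ⟨p.1, k⟩

/-- A property `P` of `v`-tuples of matrices holds generically (i.e. for a general
`g ∈ GL_{n_1}(K) × ⋯ × GL_{n_v}(K)`) if there is a nonzero polynomial `h` in the matrix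
entries such that `P g` holds for every invertible `g` with `h(g) ≠ 0`. -/
def Generically
    (P : (∀ i : Fin v, Matrix (Fin (n i + 1)) (Fin (n i + 1)) K) → Prop) : Prop :=
  ∃ h : MvPolynomial (Σ i : Fin v, Fin (n i + 1) × Fin (n i + 1)) K, h ≠ 0 ∧
    ∀ g : ∀ i : Fin v, Matrix (Fin (n i + 1)) (Fin (n i + 1)) K,
      (∀ i, IsUnit (g i).det) →
      eval (fun q : Σ i : Fin v, Fin (n i + 1) × Fin (n i + 1) => g q.1 q.2.1 q.2.2) h ≠ 0 →
      P g

/-- The leading exponent (exponent of the leading monomial) of a polynomial with respect to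
a term order `τ` (a `MonomialOrder`); by convention `leadExp τ 0 = 0`. -/
def leadExp (τ : MonomialOrder (MVar v n)) (f : MvPolynomial (MVar v n) K) :
    MVar v n →₀ ℕ :=
  τ.toSyn.symm (f.support.sup τ.toSyn)

/-- The initial ideal `in_τ(I)`: the monomial ideal generated by the leading monomials of the
nonzero elements of `I`. -/
def inIdeal (τ : MonomialOrder (MVar v n)) (I : Ideal (MvPolynomial (MVar v n) K)) :
    Ideal (MvPolynomial (MVar v n) K) :=
  Ideal.span {m | ∃ f ∈ I, f ≠ 0 ∧ m = monomial (leadExp τ f) (1 : K)}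

/-- `G` is a Gröbner basis of `I` with respect to the term order `τ`. -/
def IsGroebnerBasis (τ : MonomialOrder (MVar v n)) (G : Set (MvPolynomial (MVar v n) K))
    (I : Ideal (MvPolynomial (MVar v n) K)) : Prop :=
  G ⊆ (I : Set (MvPolynomial (MVar v n) K)) ∧
    Ideal.span ((fun f => monomial (leadExp τ f) (1 : K)) '' {f ∈ G | f ≠ 0}) = inIdeal τ I

/-- `J = gin_τ(I)`, the `ℤ^v`-graded generic initial ideal: for a general
`g ∈ GL_{n_1}(K) × ⋯ × GL_{n_v}(K)` one has `in_τ(g(I)) = J`. -/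
def IsGin (τ : MonomialOrder (MVar v n)) (I J : Ideal (MvPolynomial (MVar v n) K)) : Prop :=
  Generically fun g => inIdeal τ (Ideal.map (gAct g) I) = J

/-- A term order such that `x_{i j} > x_{i k}` whenever `j < k`. -/
def RespectsVarOrder (τ : MonomialOrder (MVar v n)) : Prop :=
  ∀ (i : Fin v) (j k : Fin (n i + 1)), j < k →
    τ.toSyn (Finsupp.single (⟨i, k⟩ : MVar v n) 1) <
      τ.toSyn (Finsupp.single (⟨i, j⟩ : MVar v n) 1)

/-- An ideal is Borel fixed if it is fixed by every element of the Borel subgroup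
`B = B_{n_1}(K) × ⋯ × B_{n_v}(K)` of upper triangular invertible matrices (upper triangular
with respect to the order `x_{i 1} > x_{i 2} > ⋯` of the variables in each row). -/
def BorelFixed (I : Ideal (MvPolynomial (MVar v n) K)) : Prop :=
  ∀ g : ∀ i : Fin v, Matrix (Fin (n i + 1)) (Fin (n i + 1)) K,
    (∀ i, IsUnit (g i).det) →
    (∀ (i : Fin v) (k j : Fin (n i + 1)), j < k → g i k j = 0) →
    Ideal.map (gAct g) I = I

/-- A Cartwright-Sturmfels ideal: a `ℤ^v`-graded ideal with the same `ℤ^v`-graded Hilbert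
series as some radical Borel fixed ideal. -/
def IsCS (I : Ideal (MvPolynomial (MVar v n) K)) : Prop :=
  IsMultigraded I ∧ ∃ J : Ideal (MvPolynomial (MVar v n) K),
    J.IsRadical ∧ BorelFixed J ∧ sameHS I J

/-- The exponent of the monomial `x_{1 1}^{a 1} ⋯ x_{v 1}^{a v}` of
`T = K[x_{1 1}, …, x_{v 1}] ⊆ S`. -/
def Tmono (v : ℕ) (n : Fin v → ℕ) (a : Fin v → ℕ) : MVar v n →₀ ℕ :=
  ∑ i : Fin v, Finsupp.single (⟨i, 0⟩ : MVar v n) (a i)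

/-- A `ℤ^v`-graded ideal of `S` extended from `T`, i.e. generated by monomials in the
variables `x_{1 1}, …, x_{v 1}`. -/
def ExtendedFromT (J : Ideal (MvPolynomial (MVar v n) K)) : Prop :=
  ∃ A : Set (Fin v → ℕ),
    J = Ideal.span ((fun a => monomial (Tmono v n a) (1 : K)) '' A)

/-- A Cartwright-Sturmfels* ideal: a `ℤ^v`-graded ideal with the same `ℤ^v`-graded Hilbert
series as some ideal extended from `T`. -/
def IsCSstar (J : Ideal (MvPolynomial (MVar v n) K)) : Prop :=
  IsMultigraded J ∧ ∃ C : Ideal (MvPolynomial (MVar v n) K), ExtendedFromT C ∧ sameHS J C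

/-- A monomial ideal. -/
def IsMonomialIdeal (I : Ideal (MvPolynomial (MVar v n) K)) : Prop :=
  ∃ A : Set (MVar v n →₀ ℕ), I = Ideal.span ((fun s => monomial s (1 : K)) '' A)

/-- A squarefree monomial ideal. -/
def IsSqfreeMonomialIdeal (I : Ideal (MvPolynomial (MVar v n) K)) : Prop :=
  ∃ A : Set (MVar v n →₀ ℕ), (∀ s ∈ A, ∀ x, s x ≤ 1) ∧
    I = Ideal.span ((fun s => monomial s (1 : K)) '' A)

/-- `J` is the Alexander dual of the squarefree monomial ideal `I`: `J` is generated by the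
products `∏_{x ∈ P} x` as `P` ranges over the minimal primes of `I`. -/
def IsAlexanderDual (I J : Ideal (MvPolynomial (MVar v n) K)) : Prop :=
  J = Ideal.span {m | ∃ F : Finset (MVar v n),
    Ideal.span ((fun x => (X x : MvPolynomial (MVar v n) K)) '' ↑F) ∈ I.minimalPrimes ∧
    m = ∏ x ∈ F, X x}

/-- The sequence `x_{i j} - λ_{i j} x_{i 1}`, `1 ≤ i ≤ v`, `2 ≤ j ≤ n_i`, as a list. -/
def LamList (lam : MVar v n → K) : List (MvPolynomial (MVar v n) K) :=
  (List.finRange v).flatMap fun i =>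
    ((List.finRange (n i + 1)).drop 1).map fun j =>
      X (⟨i, j⟩ : MVar v n) - C (lam ⟨i, j⟩) * X (⟨i, 0⟩ : MVar v n)

/-- A property of the scalars `λ = (λ_{i j})` holds for general `λ ∈ K^N` if there is a
nonzero polynomial `h` in the `λ_{i j}` such that the property holds whenever `h(λ) ≠ 0`. -/
def GenericallyLam {v : ℕ} {n : Fin v → ℕ} (K : Type) [Field K]
    (P : (MVar v n → K) → Prop) : Prop :=
  ∃ h : MvPolynomial (MVar v n) K, h ≠ 0 ∧
    ∀ lam : MVar v n → K, eval lam h ≠ 0 → P lam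

variable {K : Type} [Field K] {v : ℕ} {n : Fin v → ℕ}

/-- A graded free resolution of an ideal `I` of a polynomial ring graded by an additive
monoid `M` via a weight function `w` on the variables:
`⋯ → F_2 → F_1 → F_0 → I → 0`, where `F_p` is the free module with (finite) basis `ι p`,
the basis element `i : ι p` having degree `deg p i ∈ M`, all maps are graded of degree `0`,
and the complex is exact. -/
structure GradedFreeResolution (σ : Type) (K : Type) [Field K] (M : Type) [AddCommMonoid M]
    (w : σ → M) (I : Ideal (MvPolynomial σ K)) where
  ι : ℕ → Type
  finite : ∀ p, Finite (ι p)
  deg : ∀ p, ι p → M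
  aug : (ι 0 →₀ MvPolynomial σ K) →ₗ[MvPolynomial σ K] MvPolynomial σ K
  d : ∀ p, (ι (p + 1) →₀ MvPolynomial σ K) →ₗ[MvPolynomial σ K] (ι p →₀ MvPolynomial σ K)
  aug_graded : ∀ i : ι 0, (aug (Finsupp.single i 1)).IsWeightedHomogeneous w (deg 0 i)
  d_graded : ∀ (p : ℕ) (i : ι (p + 1)) (j : ι p),
    (d p (Finsupp.single i 1)) j = 0 ∨
      ∃ b, ((d p (Finsupp.single i 1)) j).IsWeightedHomogeneous w b ∧
        b + deg p j = deg (p + 1) i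
  range_aug : LinearMap.range aug = (I : Submodule (MvPolynomial σ K) (MvPolynomial σ K))
  exact_zero : LinearMap.ker aug = LinearMap.range (d 0)
  exact : ∀ p, LinearMap.ker (d p) = LinearMap.range (d (p + 1))

/-- A graded free resolution is minimal if all entries of the matrices of the differentials
between free modules lie in the irrelevant maximal ideal, i.e. have zero constant term. -/
def GradedFreeResolution.Minimal {σ M : Type} [AddCommMonoid M] {w : σ → M}
    {I : Ideal (MvPolynomial σ K)} (F : GradedFreeResolution σ K M w I) : Prop :=
  ∀ (p : ℕ) (i : F.ι (p + 1)) (j : F.ι p),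
    MvPolynomial.constantCoeff ((F.d p (Finsupp.single i 1)) j) = 0

/-- The graded Betti number `β_{p,a}` read off from a (minimal) graded free resolution:
the number of basis elements of `F_p` of degree `a`. -/
def GradedFreeResolution.betti {σ M : Type} [AddCommMonoid M] {w : σ → M}
    {I : Ideal (MvPolynomial σ K)} (F : GradedFreeResolution σ K M w I) (p : ℕ) (a : M) :
    ℕ :=
  Nat.card {i : F.ι p // F.deg p i = a}

/-- The set of `t × t` minors of the matrix `A`. -/
def minorsSet {R : Type} [CommRing R] (t : ℕ) {m N : ℕ} (A : Matrix (Fin m) (Fin N) R) :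
    Set R :=
  {d | ∃ (r : Fin t → Fin m) (c : Fin t → Fin N),
    Function.Injective r ∧ Function.Injective c ∧ d = (A.submatrix r c).det}

/-- `I_t(A)`, the ideal generated by the `t × t` minors of `A`. -/
def minorsIdeal {R : Type} [CommRing R] (t : ℕ) {m N : ℕ}
    (A : Matrix (Fin m) (Fin N) R) : Ideal R :=
  Ideal.span (minorsSet t A)

/-- `A` is column-graded: `N ≤ v` and each entry of the `j`-th column is either `0` or
multihomogeneous of degree `e_j ∈ ℤ^v`. -/
def ColumnGraded {m N : ℕ} (A : Matrix (Fin m) (Fin N) (MvPolynomial (MVar v n) K)) :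
    Prop :=
  ∃ h : N ≤ v, ∀ i j, A i j = 0 ∨
    (A i j).IsWeightedHomogeneous (wt v n) (Pi.single (Fin.castLE h j) 1)

/-- `A` is row-graded: `m ≤ v` and each entry of the `i`-th row is either `0` or
multihomogeneous of degree `e_i ∈ ℤ^v`. -/
def RowGraded {m N : ℕ} (A : Matrix (Fin m) (Fin N) (MvPolynomial (MVar v n) K)) : Prop :=
  ∃ h : m ≤ v, ∀ i j, A i j = 0 ∨
    (A i j).IsWeightedHomogeneous (wt v n) (Pi.single (Fin.castLE h i) 1)

/-- The exponent of the polarization of the monomial `x_{1 1}^{a 1} ⋯ x_{v 1}^{a v}` of `T`: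
the squarefree monomial `∏_i x_{i 1} x_{i 2} ⋯ x_{i (a i)}`. -/
def polExp (v : ℕ) (n : Fin v → ℕ) (a : Fin v → ℕ) : MVar v n →₀ ℕ :=
  ∑ i : Fin v, ∑ j ∈ Finset.univ.filter (fun j : Fin (n i + 1) => (j : ℕ) < a i),
    Finsupp.single (⟨i, j⟩ : MVar v n) 1

/-- `P = pol(C)`, the polarization of an ideal `C` extended from `T`
(the exponents of the generators of `C` must fit inside `S`). -/
def IsPolarizationOfT (C P : Ideal (MvPolynomial (MVar v n) K)) : Prop :=
  ∃ A : Set (Fin v → ℕ), (∀ a ∈ A, ∀ i, a i ≤ n i + 1) ∧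
    C = Ideal.span ((fun a => monomial (Tmono v n a) (1 : K)) '' A) ∧
    P = Ideal.span ((fun a => monomial (polExp v n a) (1 : K)) '' A)

/-- `ψ` is an identification of the quotient of `S` by the `ℤ^v`-graded ideal `Q` with a
standard `ℤ^v`-graded polynomial ring, compatible with the gradings. -/
def IsGradedStructureIso {n₂ : Fin v → ℕ} (Q : Ideal (MvPolynomial (MVar v n) K))
    (ψ : (MvPolynomial (MVar v n) K ⧸ Q) ≃ₐ[K] MvPolynomial (MVar v n₂) K) : Prop :=
  ∀ (f : MvPolynomial (MVar v n) K) (a : Fin v → ℕ),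
    f.IsWeightedHomogeneous (wt v n) a →
      (ψ (Ideal.Quotient.mk Q f)).IsWeightedHomogeneous (wt v n₂) a

end CSPaper

open CSPaper

namespace CSPaper

section Triangular

variable {K σ : Type*} [Field K]

/-- A subspace of polynomials containing, for each exponent `d` of a finite set `D`, an element
whose `r`-largest exponent is `d`, has dimension at least the cardinality of `D`. -/
theorem ncard_le_finrank_of_triangular {L : Type*} [LinearOrder L] (r : (σ →₀ ℕ) → L)
    (W : Submodule K (MvPolynomial σ K)) [FiniteDimensional K W] {D : Set (σ →₀ ℕ)}
    (hD : D.Finite)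
    (h : ∀ d ∈ D, ∃ f ∈ W, coeff d f ≠ 0 ∧ ∀ d', coeff d' f ≠ 0 → d' ≠ d → r d' < r d) :
    D.ncard ≤ Module.finrank K W := by
  classical
  choose F hFW hF0 hFlt using fun d : D => h d d.2
  have := hD.fintype
  have hli : LinearIndependent K F := by
    rw [linearIndependent_iff']
    intro s c hsum
    by_contra! hne
    obtain ⟨i₀, hi₀, hci₀⟩ := hne
    obtain ⟨i, hi, hmax⟩ := (s.filter (fun i => c i ≠ 0)).exists_max_image (fun i => r i.1)
      ⟨i₀, by simp [hi₀, hci₀]⟩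
    rw [Finset.mem_filter] at hi
    have hcoeff := congrArg (coeff i.1) hsum
    rw [coeff_sum, Finset.sum_eq_single_of_mem i hi.1] at hcoeff
    · simp [hi.2, hF0 i] at hcoeff
    · intro j hj hji
      by_contra hne
      rw [coeff_smul, smul_eq_mul, ← ne_eq, mul_ne_zero_iff] at hne
      have h1 := hFlt j i.1 hne.2 (fun h => hji (Subtype.ext h.symm))
      exact absurd (hmax j (by simp [hj, hne.1])) (not_le.2 h1)
  have hli' : LinearIndependent K (fun d => (⟨F d, hFW d⟩ : W)) :=
    LinearIndependent.of_comp W.subtype hli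
  rw [← Nat.card_coe_set_eq, Nat.card_eq_fintype_card]
  exact hli'.fintype_card_le_finrank

theorem finiteDimensional_restrictSupport {D : Set (σ →₀ ℕ)} (hD : D.Finite) :
    FiniteDimensional K (restrictSupport K D) :=
  have := hD.to_subtype
  Module.Finite.of_basis (basisRestrictSupport K D)

theorem finrank_restrictSupport (D : Set (σ →₀ ℕ)) :
    Module.finrank K (restrictSupport K D) = D.ncard := by
  rw [Module.finrank_eq_nat_card_basis (basisRestrictSupport K D), Nat.card_coe_set_eq]

end Triangular

section Weight

variable {v : ℕ} {n : Fin v → ℕ}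

theorem weight_wt_apply (d : MVar v n →₀ ℕ) (i : Fin v) :
    Finsupp.weight (wt v n) d i = ∑ j, d ⟨i, j⟩ := by
  rw [Finsupp.weight_apply, Finsupp.sum_fintype _ _ (by simp), Finset.sum_apply,
    Fintype.sum_sigma, Finset.sum_eq_single_of_mem i (Finset.mem_univ i)]
  · simp [wt]
  · intro k _ hk
    simp [wt, hk.symm]

theorem finite_weight_wt_eq (a : Fin v → ℕ) :
    {d : MVar v n →₀ ℕ | Finsupp.weight (wt v n) d = a}.Finite := by
  refine (Set.finite_Iic (Finsupp.equivFunOnFinite.symm fun p : MVar v n => a p.1)).subset ?_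
  rintro d rfl ⟨i, j⟩
  simpa [weight_wt_apply] using
    Finset.single_le_sum (f := fun j => d ⟨i, j⟩) (fun _ _ => Nat.zero_le _) (Finset.mem_univ j)

/-- The exponent obtained by replacing each variable `x_{i j}` with `x_{i 1}`. -/
def collapse (m : MVar v n →₀ ℕ) : MVar v n →₀ ℕ :=
  m.mapDomain fun p => ⟨p.1, 0⟩

theorem collapse_add (m m' : MVar v n →₀ ℕ) :
    collapse (m + m') = collapse m + collapse m' :=
  Finsupp.mapDomain_add

theorem collapse_single (p : MVar v n) (k : ℕ) :
    collapse (Finsupp.single p k) = Finsupp.single ⟨p.1, 0⟩ k :=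
  Finsupp.mapDomain_single

theorem weight_collapse (m : MVar v n →₀ ℕ) :
    Finsupp.weight (wt v n) (collapse m) = Finsupp.weight (wt v n) m := by
  induction m using Finsupp.induction_linear with
  | zero => simp [collapse]
  | add f g hf hg => rw [collapse_add, map_add, map_add, hf, hg]
  | single p k => rw [collapse_single, Finsupp.weight_single, Finsupp.weight_single, wt, wt]

theorem Tmono_add (a b : Fin v → ℕ) : Tmono v n (a + b) = Tmono v n a + Tmono v n b := by
  simp [Tmono, Finset.sum_add_distrib]

theorem Tmono_mono : Monotone (Tmono v n) := by
  intro a b h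
  obtain ⟨c, rfl⟩ := exists_add_of_le h
  rw [Tmono_add]
  exact le_self_add

theorem Tmono_weight (m : MVar v n →₀ ℕ) :
    Tmono v n (Finsupp.weight (wt v n) m) = collapse m := by
  induction m using Finsupp.induction_linear with
  | zero => simp [collapse, Tmono]
  | add f g hf hg => rw [collapse_add, map_add, Tmono_add, hf, hg]
  | single p k =>
    rw [collapse_single, Finsupp.weight_single, Tmono,
      Finset.sum_eq_single_of_mem p.1 (Finset.mem_univ _)]
    · simp [wt]
    · intro i _ hi
      simp [wt, hi]

theorem weight_Tmono (a : Fin v → ℕ) : Finsupp.weight (wt v n) (Tmono v n a) = a := by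
  ext i
  simp only [Tmono, map_sum, Finsupp.weight_single, Finset.sum_apply, wt]
  rw [Finset.sum_eq_single_of_mem i (Finset.mem_univ _)]
  · simp
  · intro k _ hk
    simp [hk.symm]

end Weight

section Shear

variable {K : Type} [Field K] {v : ℕ} {n : Fin v → ℕ}

/-- The substitution `x_{i j} ↦ x_{i j} + c x_{i 1}` for `j ≠ 1`, fixing `x_{i 1}`. -/
def shear (c : K) : MvPolynomial (MVar v n) K →ₐ[K] MvPolynomial (MVar v n) K :=
  aeval fun p => if p.2 = 0 then X p else X p + C c * X ⟨p.1, 0⟩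

theorem shear_X (c : K) (p : MVar v n) :
    shear c (X p) = if p.2 = 0 then X p else X p + C c * X ⟨p.1, 0⟩ :=
  aeval_X _ _

theorem shear_shear_neg (c : K) (f : MvPolynomial (MVar v n) K) :
    shear c (shear (-c) f) = f := by
  suffices h : (shear c).comp (shear (-c)) = AlgHom.id K (MvPolynomial (MVar v n) K) from
    DFunLike.congr_fun h f
  ext1 p
  rw [AlgHom.comp_apply, shear_X, AlgHom.id_apply]
  split_ifs with h
  · rw [shear_X, if_pos h]
  · rw [map_add, map_mul, shear_X, shear_X, if_neg h, if_pos rfl, ← algebraMap_eq,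
      AlgHom.commutes, algebraMap_eq, C_neg]
    ring

theorem isWeightedHomogeneous_shear_monomial (c : K) (m : MVar v n →₀ ℕ) :
    (shear c (monomial m 1)).IsWeightedHomogeneous (wt v n) (Finsupp.weight (wt v n) m) := by
  induction m using Finsupp.induction_linear with
  | zero => simpa using isWeightedHomogeneous_one K (wt v n)
  | add f g hf hg =>
    rw [← one_mul (1 : K), ← monomial_mul, map_mul, map_add]
    exact hf.mul hg
  | single p k =>
    rw [← X_pow_eq_monomial, map_pow, Finsupp.weight_single, shear_X]
    refine IsWeightedHomogeneous.pow ?_ k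
    split_ifs
    · exact isWeightedHomogeneous_X K (wt v n) p
    · refine Submodule.add_mem (weightedHomogeneousSubmodule K (wt v n) _)
        (isWeightedHomogeneous_X K (wt v n) p) ?_
      rw [← smul_eq_C_mul]
      exact Submodule.smul_mem (weightedHomogeneousSubmodule K (wt v n) _) c
        (isWeightedHomogeneous_X K (wt v n) ⟨p.1, 0⟩)

/-- The weight giving the total degree in the variables `x_{i 1}`. -/
def firstWeight : MVar v n → ℕ := fun p => if p.2 = 0 then 1 else 0

/-- `f` is the monomial with exponent `e` plus terms of smaller degree in the `x_{i 1}`. -/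
def HasFirstLead (e : MVar v n →₀ ℕ) (f : MvPolynomial (MVar v n) K) : Prop :=
  ∀ d, coeff d (f - monomial e 1) ≠ 0 →
    Finsupp.weight firstWeight d < Finsupp.weight firstWeight e

theorem hasFirstLead_monomial (e : MVar v n →₀ ℕ) :
    HasFirstLead e (monomial e (1 : K)) := by
  simp [HasFirstLead]

theorem HasFirstLead.lt {e d : MVar v n →₀ ℕ} {f : MvPolynomial (MVar v n) K}
    (h : HasFirstLead e f) (hd : coeff d f ≠ 0) (hne : d ≠ e) :
    Finsupp.weight firstWeight d < Finsupp.weight firstWeight e :=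
  h d (by classical simpa [coeff_monomial, hne.symm] using hd)

theorem HasFirstLead.coeff_ne_zero {e : MVar v n →₀ ℕ} {f : MvPolynomial (MVar v n) K}
    (h : HasFirstLead e f) : coeff e f ≠ 0 := by
  intro h0
  exact lt_irrefl _ (h e (by simp [h0]))

theorem HasFirstLead.mul {e₁ e₂ : MVar v n →₀ ℕ} {f₁ f₂ : MvPolynomial (MVar v n) K}
    (h₁ : HasFirstLead e₁ f₁) (h₂ : HasFirstLead e₂ f₂) :
    HasFirstLead (e₁ + e₂) (f₁ * f₂) := by
  classical
  intro d hd
  have hsplit : f₁ * f₂ - monomial (e₁ + e₂) 1 =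
      (f₁ - monomial e₁ 1) * f₂ + monomial e₁ 1 * (f₂ - monomial e₂ 1) := by
    rw [← one_mul (1 : K), ← monomial_mul, one_mul]
    ring
  rw [hsplit, ← mem_support_iff] at hd
  rw [map_add]
  rcases Finset.mem_union.1 (support_add hd) with hd | hd
  · obtain ⟨d₁, hd₁, d₂, hd₂, rfl⟩ := Finset.mem_add.1 (support_mul _ _ hd)
    rw [map_add]
    refine add_lt_add_of_lt_of_le (h₁ d₁ (mem_support_iff.1 hd₁)) ?_
    by_cases hde : d₂ = e₂
    · rw [hde]
    · exact (h₂.lt (mem_support_iff.1 hd₂) hde).le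
  · obtain ⟨d₁, hd₁, d₂, hd₂, rfl⟩ := Finset.mem_add.1 (support_mul _ _ hd)
    rw [Finset.mem_singleton.1 (support_monomial_subset hd₁), map_add]
    exact Nat.add_lt_add_left (h₂ d₂ (mem_support_iff.1 hd₂)) _

theorem HasFirstLead.pow {e : MVar v n →₀ ℕ} {f : MvPolynomial (MVar v n) K}
    (h : HasFirstLead e f) (k : ℕ) : HasFirstLead (k • e) (f ^ k) := by
  induction k with
  | zero => simpa using hasFirstLead_monomial (K := K) (0 : MVar v n →₀ ℕ)
  | succ k ih => rw [pow_succ, succ_nsmul]; exact ih.mul h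

theorem hasFirstLead_shear_monomial (m : MVar v n →₀ ℕ) :
    HasFirstLead (collapse m) (shear (1 : K) (monomial m 1)) := by
  classical
  induction m using Finsupp.induction_linear with
  | zero => simpa [collapse] using hasFirstLead_monomial (K := K) (0 : MVar v n →₀ ℕ)
  | add f g hf hg =>
    rw [← one_mul (1 : K), ← monomial_mul, one_mul, map_mul, collapse_add]
    exact hf.mul hg
  | single p k =>
    rw [← X_pow_eq_monomial, map_pow, collapse_single, shear_X, ← mul_one k, ← smul_eq_mul,
      ← Finsupp.smul_single, smul_eq_mul, mul_one]
    refine HasFirstLead.pow ?_ k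
    split_ifs with h
    · rw [show (⟨p.1, 0⟩ : MVar v n) = p from Sigma.ext rfl (heq_of_eq h.symm)]
      exact hasFirstLead_monomial _
    · intro d hd
      have hX : X p + C 1 * X ⟨p.1, 0⟩ - monomial (Finsupp.single ⟨p.1, 0⟩ 1) 1 =
          (X p : MvPolynomial (MVar v n) K) := by
        rw [C_1, one_mul, X, X]
        ring
      rw [hX, coeff_X] at hd
      have hd : Finsupp.single p 1 = d := by by_contra hne; simp [hne] at hd
      simp [← hd, Finsupp.weight_single, firstWeight, h]

end Shear

section Groebner

variable {K : Type} [Field K] {v : ℕ} {n : Fin v → ℕ}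

theorem finiteDimensional_degreePart (I : Ideal (MvPolynomial (MVar v n) K)) (a : Fin v → ℕ) :
    FiniteDimensional K ((Submodule.restrictScalars K I ⊓
      weightedHomogeneousSubmodule K (wt v n) a : Submodule K (MvPolynomial (MVar v n) K))) := by
  have := finiteDimensional_restrictSupport (K := K) (finite_weight_wt_eq (n := n) a)
  refine Submodule.finiteDimensional_of_le
    (S₂ := restrictSupport K {d | Finsupp.weight (wt v n) d = a}) ?_
  intro f hf d hd
  exact hf.2 (mem_support_iff.1 hd)

/-- The exponents of multidegree `a` of an ideal extended from `T` are at most as many as those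
of an ideal containing, for every generator of the former, a monomial of smaller multidegree. -/
theorem ncard_Tmono_le_ncard {A : Set (Fin v → ℕ)} {B : Set (MVar v n →₀ ℕ)}
    (h : ∀ b ∈ A, ∃ m ∈ B, Finsupp.weight (wt v n) m ≤ b) (a : Fin v → ℕ) :
    {u | Finsupp.weight (wt v n) u = a ∧ ∃ b ∈ A, Tmono v n b ≤ u}.ncard ≤
      {d | Finsupp.weight (wt v n) d = a ∧ ∃ m ∈ B, m ≤ d}.ncard := by
  classical
  set D := {d | Finsupp.weight (wt v n) d = a ∧ ∃ m ∈ B, m ≤ d}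
  have hD : D.Finite := (finite_weight_wt_eq a).subset fun d hd => hd.1
  have := finiteDimensional_restrictSupport (K := ℚ) hD
  rw [← finrank_restrictSupport (K := ℚ) D]
  refine le_trans ?_ (Submodule.finrank_map_le (shear (1 : ℚ)).toLinearMap _)
  refine ncard_le_finrank_of_triangular (Finsupp.weight firstWeight) _
    ((finite_weight_wt_eq a).subset fun u hu => hu.1) ?_
  rintro u ⟨hua, b, hb, hbu⟩
  obtain ⟨m, hm, hmb⟩ := h b hb
  obtain ⟨w, rfl⟩ := exists_add_of_le
    ((Tmono_weight m).symm.le.trans ((Tmono_mono hmb).trans hbu))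
  have hlead : HasFirstLead (collapse m + w)
      (shear (1 : ℚ) (monomial m 1 * shear (-1) (monomial w 1))) := by
    rw [map_mul, shear_shear_neg]
    exact (hasFirstLead_shear_monomial m).mul (hasFirstLead_monomial w)
  refine ⟨_, Submodule.mem_map_of_mem ?_, hlead.coeff_ne_zero, fun d hd => hlead.lt hd⟩
  intro d hd
  obtain ⟨d₁, hd₁, d₂, hd₂, rfl⟩ := Finset.mem_add.1 (support_mul _ _ hd)
  rw [Finset.mem_singleton.1 (support_monomial_subset hd₁)]
  refine ⟨?_, m, hm, le_self_add⟩
  rw [map_add, isWeightedHomogeneous_shear_monomial _ _ (mem_support_iff.1 hd₂), ← hua, map_add,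
    weight_collapse]

theorem hilb_span_Tmono_le (A : Set (Fin v → ℕ)) (a : Fin v → ℕ) :
    hilb (Ideal.span ((fun b => monomial (Tmono v n b) (1 : K)) '' A)) a ≤
      {u | Finsupp.weight (wt v n) u = a ∧ ∃ b ∈ A, Tmono v n b ≤ u}.ncard := by
  rw [← finrank_restrictSupport (K := K)]
  have := finiteDimensional_restrictSupport (K := K) (D := {u : MVar v n →₀ ℕ |
    Finsupp.weight (wt v n) u = a ∧ ∃ b ∈ A, Tmono v n b ≤ u})
    ((finite_weight_wt_eq a).subset fun u hu => hu.1)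
  refine Submodule.finrank_mono ?_
  rintro f ⟨hf, hfa⟩ d hd
  refine ⟨hfa (mem_support_iff.1 hd), ?_⟩
  have hf : f ∈ Ideal.span ((fun s => monomial s (1 : K)) '' (Tmono v n '' A)) := by
    rwa [Set.image_image]
  obtain ⟨_, ⟨b, hb, rfl⟩, hbd⟩ := mem_ideal_span_monomial_image.1 hf d hd
  exact ⟨b, hb, hbd⟩

theorem exists_ne_zero_of_hilb_ne_zero {I : Ideal (MvPolynomial (MVar v n) K)} {a : Fin v → ℕ}
    (h : hilb I a ≠ 0) : ∃ f ∈ I, f ≠ 0 ∧ f.IsWeightedHomogeneous (wt v n) a := by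
  obtain ⟨f, hf, hf0⟩ := Submodule.exists_mem_ne_zero_of_ne_bot
    (p := Submodule.restrictScalars K I ⊓ weightedHomogeneousSubmodule K (wt v n) a)
    fun hbot => h (by rw [hilb, hbot, finrank_bot])
  exact ⟨f, hf.1, hf0, hf.2⟩

theorem hilb_ne_zero {I : Ideal (MvPolynomial (MVar v n) K)} {a : Fin v → ℕ}
    {f : MvPolynomial (MVar v n) K} (hf : f ∈ I) (hf0 : f ≠ 0)
    (hfa : f.IsWeightedHomogeneous (wt v n) a) : hilb I a ≠ 0 := by
  have := finiteDimensional_degreePart I a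
  rw [hilb, Ne, Submodule.finrank_eq_zero]
  exact (Submodule.ne_bot_iff _).2 ⟨f, ⟨hf, hfa⟩, hf0⟩

/-- Every exponent occurring in an element of the ideal generated by homogeneous elements has
multidegree at least that of some generator. -/
theorem exists_generator_le_weight {G : Set (MvPolynomial (MVar v n) K)}
    (hG : ∀ f ∈ G, ∃ a : Fin v → ℕ, f.IsWeightedHomogeneous (wt v n) a)
    {f : MvPolynomial (MVar v n) K} (hf : f ∈ Ideal.span G) {d : MVar v n →₀ ℕ}
    (hd : d ∈ f.support) :
    ∃ g ∈ G, ∃ c ≤ Finsupp.weight (wt v n) d, g.IsWeightedHomogeneous (wt v n) c := by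
  classical
  induction hf using Submodule.span_induction generalizing d with
  | mem g hg =>
    obtain ⟨a, ha⟩ := hG g hg
    exact ⟨g, hg, a, (ha (mem_support_iff.1 hd)).ge, ha⟩
  | zero => simp at hd
  | add f g _ _ ihf ihg =>
    rcases Finset.mem_union.1 (support_add hd) with hd | hd
    · exact ihf hd
    · exact ihg hd
  | smul p f _ ih =>
    obtain ⟨d₁, -, d₂, hd₂, rfl⟩ := Finset.mem_add.1 (support_mul _ _ hd)
    obtain ⟨g, hg, c, hc, hgc⟩ := ih hd₂
    exact ⟨g, hg, c, hc.trans (by rw [map_add]; exact le_add_self), hgc⟩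

theorem leadExp_eq_degree (τ : MonomialOrder (MVar v n)) (f : MvPolynomial (MVar v n) K) :
    leadExp τ f = τ.degree f :=
  rfl

theorem leadExp_mem_support (τ : MonomialOrder (MVar v n)) {f : MvPolynomial (MVar v n) K}
    (hf : f ≠ 0) : leadExp τ f ∈ f.support :=
  τ.degree_mem_support hf

/-- If `J` has the multigraded Hilbert function of an ideal extended from `T`, then the leading
monomial of any nonzero element of `J` is divisible by that of an element of any homogeneous
generating set. -/
theorem exists_leadExp_le {J : Ideal (MvPolynomial (MVar v n) K)} (hJ : IsCSstar J)
    {G : Set (MvPolynomial (MVar v n) K)}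
    (hGhom : ∀ f ∈ G, f ≠ 0 ∧ ∃ a : Fin v → ℕ, f.IsWeightedHomogeneous (wt v n) a)
    (hGgen : Ideal.span G = J) (τ : MonomialOrder (MVar v n))
    {f : MvPolynomial (MVar v n) K} (hf : f ∈ J) (hf0 : f ≠ 0) :
    ∃ g ∈ G, leadExp τ g ≤ leadExp τ f := by
  classical
  obtain ⟨hJgr, _, ⟨A, rfl⟩, hHS⟩ := hJ
  set e := leadExp τ f
  set a := Finsupp.weight (wt v n) e
  have hA : ∀ b ∈ A, ∃ m ∈ leadExp τ '' G, Finsupp.weight (wt v n) m ≤ b := by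
    intro b hb
    have hne : hilb J b ≠ 0 := by
      rw [hHS b]
      exact hilb_ne_zero (Ideal.subset_span ⟨b, hb, rfl⟩) (by simp)
        (isWeightedHomogeneous_monomial _ _ _ (weight_Tmono b))
    obtain ⟨p, hpJ, hp0, hpb⟩ := exists_ne_zero_of_hilb_ne_zero hne
    obtain ⟨d, hd⟩ := support_nonempty.2 hp0
    obtain ⟨g, hg, c, hc, hgc⟩ :=
      exists_generator_le_weight (fun f hf => (hGhom f hf).2) (hGgen ▸ hpJ) hd
    refine ⟨_, ⟨g, hg, rfl⟩, ?_⟩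
    rw [hgc (mem_support_iff.1 (leadExp_mem_support τ (hGhom g hg).1))]
    rwa [hpb (mem_support_iff.1 hd)] at hc
  by_contra! hnot
  set D := {d | Finsupp.weight (wt v n) d = a ∧ ∃ m ∈ leadExp τ '' G, m ≤ d}
  have hD : D.Finite := (finite_weight_wt_eq a).subset fun d hd => hd.1
  have heD : e ∉ D := by
    rintro ⟨-, _, ⟨g, hg, rfl⟩, hge⟩
    exact hnot g hg hge
  have hle : D.ncard + 1 ≤ hilb J a := by
    rw [← Set.ncard_insert_of_notMem heD hD]
    have := finiteDimensional_degreePart J a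
    refine ncard_le_finrank_of_triangular τ.toSyn _ (hD.insert e) ?_
    rintro d (rfl | ⟨hda, _, ⟨g, hg, rfl⟩, hgd⟩)
    · refine ⟨weightedHomogeneousComponent (wt v n) a f, ⟨hJgr f hf a,
        weightedHomogeneousComponent_isWeightedHomogeneous _ _⟩, ?_, ?_⟩
      · rw [coeff_weightedHomogeneousComponent, if_pos rfl]
        exact mem_support_iff.1 (leadExp_mem_support τ hf0)
      · intro d' hd' hne
        rw [coeff_weightedHomogeneousComponent] at hd'
        refine lt_of_le_of_ne (τ.le_degree (mem_support_iff.2 fun h0 => hd' (by simp [h0]))) ?_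
        exact fun h => hne (τ.toSyn.injective h)
    · obtain ⟨w, rfl⟩ := exists_add_of_le hgd
      obtain ⟨hg0, c, hgc⟩ := hGhom g hg
      have hgc' := hgc (mem_support_iff.1 (leadExp_mem_support τ hg0))
      have hmono : monomial w (1 : K) ≠ 0 := by simp
      have hdeg : leadExp τ (g * monomial w 1) = leadExp τ g + w := by
        rw [leadExp_eq_degree, τ.degree_mul hg0 hmono, τ.degree_monomial, if_neg one_ne_zero]
        rfl
      refine ⟨g * monomial w 1, ⟨J.mul_mem_right _ (hGgen ▸ Ideal.subset_span hg), ?_⟩, ?_, ?_⟩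
      · rw [← hda, map_add, hgc']
        exact hgc.mul (isWeightedHomogeneous_monomial _ _ _ rfl)
      · rw [← hdeg]
        exact mem_support_iff.1 (leadExp_mem_support τ (mul_ne_zero hg0 hmono))
      · intro d' hd' hne
        rw [← hdeg] at hne ⊢
        exact lt_of_le_of_ne (τ.le_degree (mem_support_iff.2 hd'))
          fun h => hne (τ.toSyn.injective h)
  have h₁ := hilb_span_Tmono_le (K := K) (n := n) A a
  rw [← hHS a] at h₁
  exact absurd (hle.trans (h₁.trans (ncard_Tmono_le_ncard hA a))) (Nat.not_succ_le_self _)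

end Groebner

end CSPaper

/-- Every minimal system of `ℤ^v`-homogeneous generators of a Cartwright-Sturmfels* ideal
`J` is a universal Gröbner basis of `J`. -/
theorem CSstar_universal_groebner_basis
    {K : Type} [Field K] [Infinite K] {v : ℕ} {n : Fin v → ℕ}
    (J : Ideal (MvPolynomial (MVar v n) K)) (hJ : IsCSstar J)
    (G : Set (MvPolynomial (MVar v n) K))
    (hGhom : ∀ f ∈ G, f ≠ 0 ∧ ∃ a : Fin v → ℕ, f.IsWeightedHomogeneous (wt v n) a)
    (hGgen : Ideal.span G = J)
    (hGmin : ∀ f ∈ G, f ∉ Ideal.span (G \ {f})) :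
    ∀ τ : MonomialOrder (MVar v n), IsGroebnerBasis τ G J := by
  intro τ
  have hGJ : G ⊆ (J : Set (MvPolynomial (MVar v n) K)) := hGgen ▸ Ideal.subset_span
  refine ⟨hGJ, le_antisymm (Ideal.span_le.2 ?_) (Ideal.span_le.2 ?_)⟩
  · rintro _ ⟨f, ⟨hfG, hf0⟩, rfl⟩
    exact Ideal.subset_span ⟨f, hGJ hfG, hf0, rfl⟩
  · rintro _ ⟨f, hfJ, hf0, rfl⟩
    obtain ⟨g, hg, hgf⟩ := exists_leadExp_le hJ hGhom hGgen τ hfJ hf0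
    obtain ⟨w, hw⟩ := exists_add_of_le hgf
    rw [hw, ← one_mul (1 : K), ← monomial_mul, one_mul]
    exact Ideal.mul_mem_right _ _ (Ideal.subset_span ⟨g, ⟨hg, (hGhom g hg).1⟩, rfl⟩)

end
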